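/- (Soundness of DICLIQUE-3) Let G be a digraph and v ∈ V(G) a vertex with (v,v) ∉ E(G) and no bi-edges (N_bi(v) = ∅) whose neighborhood N(v) can be partitioned into three disjoint dicliques N_1, N_2, N_3. Then DFVS(G) = DFVS(G∘v), and every DFVS of G∘v is a DFVS of G. -/

import Mathlib

namespace DFVSP

open scoped Classical

noncomputable section

variable {V : Type*} [Fintype V] [DecidableEq V]

/-- A digraph on the (finite) vertex set `V` is given by its finite set of arcs. -/
abbrev Dgraph (V : Type*) := Finset (V × V)

/-- `p` is a path in `G`: a list of vertices where consecutive vertices are joined by arcs. -/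
def IsPath (G : Dgraph V) (p : List V) : Prop :=
  List.Chain' (fun a b => (a, b) ∈ G) p

/-- `p` is a path in `G` that starts at `a` and ends at `b`. -/
def IsPathFrom (G : Dgraph V) (a b : V) (p : List V) : Prop :=
  IsPath G p ∧ p.head? = some a ∧ p.getLast? = some b

/-- `p` is a cycle in `G`: a path `v₁,…,vₙ` with `n ≥ 2` and `v₁ = vₙ`. -/
def IsCycle (G : Dgraph V) (p : List V) : Prop :=
  IsPath G p ∧ 2 ≤ p.length ∧ p.head? = p.getLast?

/-- `D` is a directed feedback vertex set of `G`: every cycle contains a vertex of `D`. -/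
def IsDFVS (G : Dgraph V) (D : Finset V) : Prop :=
  ∀ p : List V, IsCycle G p → ∃ x ∈ p, x ∈ D

/-- The minimum cardinality of a DFVS of `G`. -/
def dfvsNum (G : Dgraph V) : ℕ :=
  sInf {n | ∃ D : Finset V, IsDFVS G D ∧ D.card = n}

/-- `D` is a DFVS of `G` of minimum cardinality. -/
def IsMinDFVS (G : Dgraph V) (D : Finset V) : Prop :=
  IsDFVS G D ∧ ∀ D' : Finset V, IsDFVS G D' → D.card ≤ D'.card

/-- The predecessors of `v` in `G`. -/
def Npre (G : Dgraph V) (v : V) : Finset V := Finset.univ.filter fun p => (p, v) ∈ G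

/-- The successors of `v` in `G`. -/
def Nsucc (G : Dgraph V) (v : V) : Finset V := Finset.univ.filter fun s => (v, s) ∈ G

/-- The bi-edge neighbours of `v` in `G`. -/
def Nbi (G : Dgraph V) (v : V) : Finset V := Npre G v ∩ Nsucc G v

/-- The neighbours of `v` in `G`. -/
def Nbhd (G : Dgraph V) (v : V) : Finset V := Npre G v ∪ Nsucc G v

/-- The consecutive pairs of vertices along a list. -/
def consecutivePairs (p : List V) : List (V × V) := p.zip p.tail

/-- The path `p` uses a bi-edge of `G`. -/
def UsesBiEdge (G : Dgraph V) (p : List V) : Prop :=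
  ∃ q ∈ consecutivePairs p, (q.1, q.2) ∈ G ∧ (q.2, q.1) ∈ G

/-- A path (or cycle) `p` is uncovered in `G` if there is no cycle whose vertex set is a
proper subset of the vertex set of `p`. -/
def Uncovered (G : Dgraph V) (p : List V) : Prop :=
  ¬ ∃ q : List V, IsCycle G q ∧ q.toFinset ⊂ p.toFinset

/-- `G − v`: delete the vertex `v` together with all incident arcs. -/
def deleteVertex (G : Dgraph V) (v : V) : Dgraph V :=
  G.filter fun a => a.1 ≠ v ∧ a.2 ≠ v

/-- `G[A]`: the subdigraph induced by the vertex set `A`. -/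
def induce (G : Dgraph V) (A : Finset V) : Dgraph V :=
  G.filter fun a => a.1 ∈ A ∧ a.2 ∈ A

/-- The exclusion `G ∘ v`: delete `v` and add an arc `(p, s)` for every predecessor `p`
and successor `s` of `v`. -/
def exclude (G : Dgraph V) (v : V) : Dgraph V :=
  deleteVertex G v ∪ Npre G v ×ˢ Nsucc G v

/-- A diclique: all pairs of distinct vertices of `S` are joined by bi-edges. -/
def IsDiclique (G : Dgraph V) (S : Finset V) : Prop :=
  ∀ u ∈ S, ∀ w ∈ S, u ≠ w → (u, w) ∈ G ∧ (w, u) ∈ G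

/-- The arcs of `G` that avoid `D`, as a relation. -/
def AvoidingArc (G : Dgraph V) (D : Finset V) (a b : V) : Prop :=
  (a, b) ∈ G ∧ a ∉ D ∧ b ∉ D

omit [Fintype V] [DecidableEq V] in
lemma exists_path_of_transGen {G : Dgraph V} {D : Finset V} {a b : V}
    (h : Relation.TransGen (AvoidingArc G D) a b) :
    ∃ l : List V, l ≠ [] ∧ List.IsChain (fun a b => (a, b) ∈ G) (a :: l) ∧
      (a :: l).getLast? = some b ∧ ∀ x ∈ a :: l, x ∉ D := by
  induction h using Relation.TransGen.head_induction_on with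
  | single h => exact ⟨[b], by simp, by simpa using h.1, by simp, by simpa using h.2⟩
  | head h _ ih =>
    obtain ⟨l, -, hc, hlast, hD⟩ := ih
    refine ⟨_ :: l, by simp, List.isChain_cons_cons.2 ⟨h.1, hc⟩, ?_, ?_⟩
    · rwa [List.getLast?_cons_cons]
    · exact List.forall_mem_cons.2 ⟨h.2.1, hD⟩

omit [Fintype V] [DecidableEq V] in
lemma transGen_of_path {G : Dgraph V} {D : Finset V} (l : List V) (a b c : V)
    (hc : List.IsChain (fun a b => (a, b) ∈ G) (a :: c :: l))
    (hlast : (a :: c :: l).getLast? = some b) (hD : ∀ x ∈ a :: c :: l, x ∉ D) :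
    Relation.TransGen (AvoidingArc G D) a b := by
  induction l generalizing a c with
  | nil =>
    obtain rfl : c = b := by simpa using hlast
    exact .single ⟨by simpa using hc, hD _ (by simp), hD _ (by simp)⟩
  | cons d l ih =>
    rw [List.isChain_cons_cons] at hc
    rw [List.getLast?_cons_cons] at hlast
    exact .head ⟨hc.1, hD _ (by simp), hD _ (by simp)⟩
      (ih c d hc.2 hlast fun x hx => hD x (List.mem_cons_of_mem _ hx))

omit [Fintype V] in
lemma isDFVS_iff_transGen {G : Dgraph V} {D : Finset V} :
    IsDFVS G D ↔ ∀ x, ¬ Relation.TransGen (AvoidingArc G D) x x := by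
  constructor
  · intro h x hx
    obtain ⟨l, hne, hc, hlast, hD⟩ := exists_path_of_transGen hx
    obtain ⟨y, hy, hyD⟩ := h (x :: l)
      ⟨hc, by have := List.length_pos_of_ne_nil hne; simp; omega, by rw [hlast]; rfl⟩
    exact hD y hy hyD
  · rintro h p ⟨hc, hlen, hends⟩
    by_contra! hD
    match p, hlen with
    | a :: c :: l, _ => exact h a (transGen_of_path l a a c hc hends.symm hD)

lemma mem_exclude {G : Dgraph V} {v a b : V} :
    (a, b) ∈ exclude G v ↔
      ((a, b) ∈ G ∧ a ≠ v ∧ b ≠ v) ∨ ((a, v) ∈ G ∧ (v, b) ∈ G) := by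
  simp [exclude, deleteVertex, Npre, Nsucc]

lemma IsDFVS.exclude_of_notMem {G : Dgraph V} {D : Finset V} {v : V} (h : IsDFVS G D)
    (hv : v ∉ D) : IsDFVS (exclude G v) D := by
  rw [isDFVS_iff_transGen] at h ⊢
  refine fun x hx => h x (Relation.TransGen.closed ?_ x x hx)
  rintro a b ⟨hab, ha, hb⟩
  rcases mem_exclude.1 hab with hab | hab
  · exact .single ⟨hab.1, ha, hb⟩
  · exact .head ⟨hab.1, ha, hv⟩ (.single ⟨hab.2, hv, hb⟩)

lemma IsDFVS.exclude_of_erase_subset {G : Dgraph V} {D D' : Finset V} {v : V}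
    (h : IsDFVS G D) (hD : D.erase v ⊆ D') (hN : Npre G v ⊆ D' ∨ Nsucc G v ⊆ D') :
    IsDFVS (exclude G v) D' := by
  rw [isDFVS_iff_transGen] at h ⊢
  refine fun x hx => h x (Relation.TransGen.mono ?_ x x hx)
  rintro a b ⟨hab, ha, hb⟩
  rcases mem_exclude.1 hab with ⟨hab, hav, hbv⟩ | ⟨hav, hvb⟩
  · exact ⟨hab, fun h => ha (hD (Finset.mem_erase.2 ⟨hav, h⟩)),
      fun h => hb (hD (Finset.mem_erase.2 ⟨hbv, h⟩))⟩
  · rcases hN with hN | hN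
    · exact absurd (hN (by simpa [Npre] using hav)) ha
    · exact absurd (hN (by simpa [Nsucc] using hvb)) hb

lemma transGen_exclude {G : Dgraph V} {D : Finset V} {v : V} (hloop : (v, v) ∉ G) {a b : V}
    (hav : a ≠ v) (h : Relation.TransGen (AvoidingArc G D) a b) :
    (b ≠ v → Relation.TransGen (AvoidingArc (exclude G v) D) a b) ∧
      (b = v → ∃ p, (p, v) ∈ G ∧ p ∉ D ∧
        Relation.ReflTransGen (AvoidingArc (exclude G v) D) a p) := by
  induction h with
  | single h =>
    refine ⟨fun hb => .single ⟨mem_exclude.2 (.inl ⟨h.1, hav, hb⟩), h.2⟩, ?_⟩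
    rintro rfl
    exact ⟨a, h.1, h.2.1, .refl⟩
  | @tail b c _ h ih =>
    by_cases hb : b = v
    · subst hb
      obtain ⟨p, hp, hpD, hap⟩ := ih.2 rfl
      refine ⟨fun _ => .tail' hap ⟨mem_exclude.2 (.inr ⟨hp, h.1⟩), hpD, h.2.2⟩, ?_⟩
      rintro rfl
      exact absurd h.1 hloop
    · refine ⟨fun hc => (ih.1 hb).tail ⟨mem_exclude.2 (.inl ⟨h.1, hb, hc⟩), h.2⟩, ?_⟩
      rintro rfl
      exact ⟨b, h.1, h.2.1, (ih.1 hb).to_reflTransGen⟩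

lemma IsDFVS.of_exclude {G : Dgraph V} {D : Finset V} {v : V} (hloop : (v, v) ∉ G)
    (h : IsDFVS (exclude G v) D) : IsDFVS G D := by
  rw [isDFVS_iff_transGen] at h ⊢
  have key : ∀ x, x ≠ v → ¬ Relation.TransGen (AvoidingArc G D) x x :=
    fun x hxv hx => h x ((transGen_exclude hloop hxv hx).1 hxv)
  intro x hx
  by_cases hxv : x = v
  · subst hxv
    obtain ⟨c, hc, hcx⟩ := Relation.TransGen.head'_iff.1 hx
    refine key c ?_ (.tail' hcx hc)
    rintro rfl
    exact hloop hc.1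
  · exact key x hxv hx

omit [Fintype V] in
lemma IsDiclique.card_sdiff_le_one {G : Dgraph V} {D S : Finset V} (hS : IsDiclique G S)
    (h : IsDFVS G D) : (S \ D).card ≤ 1 := by
  rw [isDFVS_iff_transGen] at h
  refine Finset.card_le_one.2 fun a ha b hb => ?_
  rw [Finset.mem_sdiff] at ha hb
  by_contra hab
  have hbi := hS a ha.1 b hb.1 hab
  exact h a (.head ⟨hbi.1, ha.2, hb.2⟩ (.single ⟨hbi.2, hb.2, ha.2⟩))

lemma dfvsNum_le_dfvsNum {G H : Dgraph V}
    (h : ∀ D, IsDFVS H D → ∃ D', IsDFVS G D' ∧ D'.card ≤ D.card) :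
    dfvsNum G ≤ dfvsNum H := by
  have hne : {n | ∃ D : Finset V, IsDFVS H D ∧ D.card = n}.Nonempty := by
    refine ⟨_, Finset.univ, isDFVS_iff_transGen.2 fun x hx => ?_, rfl⟩
    obtain ⟨c, hc, -⟩ := Relation.TransGen.head'_iff.1 hx
    exact hc.2.1 (Finset.mem_univ x)
  obtain ⟨D, hD, hcard⟩ := Nat.sInf_mem hne
  obtain ⟨D', hD', hle⟩ := h D hD
  have hmin : dfvsNum G ≤ D'.card := Nat.sInf_le ⟨D', hD', rfl⟩
  exact hmin.trans (hle.trans hcard.le)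

lemma card_sdiff_le_one_or {G : Dgraph V} {v : V} {D N1 N2 N3 : Finset V}
    (hnobi : Nbi G v = ∅) (hcover : N1 ∪ N2 ∪ N3 = Nbhd G v)
    (hd1 : IsDiclique G N1) (hd2 : IsDiclique G N2) (hd3 : IsDiclique G N3)
    (h : IsDFVS G D) : (Npre G v \ D).card ≤ 1 ∨ (Nsucc G v \ D).card ≤ 1 := by
  have hdisj : Disjoint (Npre G v \ D) (Nsucc G v \ D) :=
    (Finset.disjoint_iff_inter_eq_empty.2 hnobi).mono Finset.sdiff_subset Finset.sdiff_subset
  have hunion : (Npre G v \ D) ∪ (Nsucc G v \ D) = N1 \ D ∪ N2 \ D ∪ N3 \ D := by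
    rw [← Finset.union_sdiff_distrib, ← Finset.union_sdiff_distrib,
      ← Finset.union_sdiff_distrib, hcover, Nbhd]
  have hcard := Finset.card_union_of_disjoint hdisj
  rw [hunion] at hcard
  have hle := Finset.card_union_le (N1 \ D ∪ N2 \ D) (N3 \ D)
  have hle' := Finset.card_union_le (N1 \ D) (N2 \ D)
  have h1 := hd1.card_sdiff_le_one h
  have h2 := hd2.card_sdiff_le_one h
  have h3 := hd3.card_sdiff_le_one h
  omega

lemma IsDFVS.exists_exclude_of_card_sdiff_le_one {G : Dgraph V} {v : V} {D N : Finset V}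
    (h : IsDFVS G D) (hv : v ∈ D) (hN : N = Npre G v ∨ N = Nsucc G v)
    (hcard : (N \ D).card ≤ 1) (hvN : v ∉ N) :
    ∃ D', IsDFVS (exclude G v) D' ∧ D'.card ≤ D.card := by
  refine ⟨D.erase v ∪ N \ D, h.exclude_of_erase_subset Finset.subset_union_left ?_, ?_⟩
  · have hsub : N ⊆ D.erase v ∪ N \ D := by
      intro x hx
      have hxv : x ≠ v := fun e => hvN (e ▸ hx)
      simp only [Finset.mem_union, Finset.mem_erase, Finset.mem_sdiff]
      tauto
    rcases hN with rfl | rfl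
    · exact .inl hsub
    · exact .inr hsub
  · have hle := Finset.card_union_le (D.erase v) (N \ D)
    have herase := Finset.card_erase_add_one hv
    omega

/-- soundness of DICLIQUE-3. -/
theorem diclique3_sound (G : Dgraph V) (v : V) (hloop : (v, v) ∉ G)
    (hnobi : Nbi G v = ∅)
    (N1 N2 N3 : Finset V)
    (hpart : N1 ∪ N2 ∪ N3 = Nbhd G v)
    (h12 : Disjoint N1 N2) (h13 : Disjoint N1 N3) (h23 : Disjoint N2 N3)
    (hd1 : IsDiclique G N1) (hd2 : IsDiclique G N2) (hd3 : IsDiclique G N3) :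
    dfvsNum G = dfvsNum (exclude G v) ∧
      ∀ D : Finset V, IsDFVS (exclude G v) D → IsDFVS G D := by
  refine ⟨le_antisymm ?_ ?_, fun D hD => hD.of_exclude hloop⟩
  · exact dfvsNum_le_dfvsNum fun D hD => ⟨D, hD.of_exclude hloop, le_rfl⟩
  · refine dfvsNum_le_dfvsNum fun D hD => ?_
    by_cases hv : v ∈ D
    · rcases card_sdiff_le_one_or hnobi hpart hd1 hd2 hd3 hD with hcard | hcard
      · exact hD.exists_exclude_of_card_sdiff_le_one hv (.inl rfl) hcard (by simpa [Npre])
      · exact hD.exists_exclude_of_card_sdiff_le_one hv (.inr rfl) hcard (by simpa [Nsucc])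
    · exact ⟨D, hD.exclude_of_notMem hv, le_rfl⟩

end

end DFVSP
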